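/- arXiv:2409.19822 — 5 statements merged into one kernel-verified Lean document; each statement's English description precedes it below -/
import Mathlib

section
/- Let H > 300 be a real number, and let x = (x₁,x₂), y = (y₁,y₂) ∈ ℝ² satisfy x₂ > 0, y₂ > 0 and x ≠ y. Then log(|x−ȳ|/|x−y|) ≤ φ(|x−y|) + g^H(2x₂) + 300/H, where ȳ = (y₁,−y₂). -/
open MeasureTheory Real

noncomputable section

/-- The plane `ℝ²` with Euclidean norm. -/
abbrev E2 : Type := EuclideanSpace ℝ (Fin 2)

/-- Construct a point of `ℝ²` from coordinates. -/
def pt (a b : ℝ) : E2 := (WithLp.equiv 2 (Fin 2 → ℝ)).symm ![a, b]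

/-- The reflection `ȳ = (y₁, −y₂)`. -/
def bar (y : E2) : E2 := pt (y 0) (-(y 1))

/-- `φ(s) = −log s` for `0 < s < 3` and `φ(s) = −log 3` for `s ≥ 3`. -/
def phi (s : ℝ) : ℝ := if s < 3 then -Real.log s else -Real.log 3

/-- `g^H(s) = log s` for `s ≥ H`, and `g^H(s) = log H + (s−H)/H` for `0 ≤ s < H`. -/
def gH (H s : ℝ) : ℝ := if H ≤ s then Real.log s else Real.log H + (s - H) / H

/-- `g^H` dominates the logarithm, up to a linear error in the shift of the argument. -/
lemma log_add_le_gH {H s t : ℝ} (hH : 0 < H) (hs : 0 < s) (ht : 0 ≤ t) :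
    Real.log (s + t) ≤ gH H s + t / H := by
  have tangent : ∀ {a : ℝ}, 0 < a → Real.log (s + t) ≤ Real.log a + (s + t - a) / a := by
    intro a ha
    have h := Real.log_le_sub_one_of_pos (show 0 < (s + t) / a by positivity)
    rw [Real.log_div (by positivity) ha.ne'] at h
    rw [sub_div, div_self ha.ne']
    linarith
  unfold gH
  split_ifs with h
  · have h1 := tangent hs
    rw [add_sub_cancel_left] at h1
    linarith [div_le_div_of_nonneg_left ht hH h]
  · have h1 := tangent hH
    rw [show s + t - H = (s - H) + t by ring, add_div] at h1
    linarith

/-- Reflecting `y` moves its distance to `x` by at most twice the height of `x`. -/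
lemma norm_sub_bar_le (x y : E2) (hx : 0 ≤ x 1) : ‖x - bar y‖ ≤ ‖x - y‖ + 2 * x 1 := by
  have h1 : ‖x - bar x‖ = 2 * x 1 := by
    rw [EuclideanSpace.norm_eq, Real.sqrt_eq_iff_mul_self_eq (by positivity) (by positivity)]
    simp [bar, pt, Fin.sum_univ_two]
    ring
  have h2 : ‖bar x - bar y‖ = ‖x - y‖ := by
    simp only [EuclideanSpace.norm_eq, Fin.sum_univ_two, Real.norm_eq_abs, sq_abs]
    congr 1
    simp [bar, pt]
    ring
  linarith [norm_sub_le_norm_sub_add_norm_sub x (bar x) (bar y)]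

/-- The reflection of a point of the upper half-plane lies outside it. -/
lemma norm_sub_bar_pos (x y : E2) (hx : 0 < x 1) (hy : 0 < y 1) : 0 < ‖x - bar y‖ := by
  rw [norm_pos_iff, sub_ne_zero]
  intro h
  have h1 : x 1 = -(y 1) := by rw [h]; simp [bar, pt]
  linarith

/-- Key pointwise kernel estimate: for `H > 300`, `x₂ > 0`, `y₂ > 0` and `x ≠ y`,
`log(|x−ȳ|/|x−y|) ≤ φ(|x−y|) + g^H(2x₂) + 300/H`. -/
theorem key_kernel_estimate (H : ℝ) (hH : 300 < H) (x y : E2)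
    (hx2 : 0 < x 1) (hy2 : 0 < y 1) (hxy : x ≠ y) :
    Real.log (‖x - bar y‖ / ‖x - y‖) ≤ phi ‖x - y‖ + gH H (2 * x 1) + 300 / H := by
  have hD : 0 < ‖x - y‖ := norm_pos_iff.mpr (sub_ne_zero.mpr hxy)
  have hB := norm_sub_bar_pos x y hx2 hy2
  have hle := norm_sub_bar_le x y hx2.le
  have hg := log_add_le_gH (H := H) (s := 2 * x 1) (t := 3) (by linarith) (by linarith) (by norm_num)
  have hH3 : 3 / H ≤ 300 / H := div_le_div_of_nonneg_right (by norm_num) (by linarith)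
  rw [Real.log_div hB.ne' hD.ne']
  unfold phi
  split_ifs with h
  · have := Real.log_le_log hB (show ‖x - bar y‖ ≤ 2 * x 1 + 3 by linarith)
    linarith
  · rw [not_lt] at h
    have hmul : 3 * ‖x - bar y‖ ≤ (2 * x 1 + 3) * ‖x - y‖ := by
      nlinarith [mul_nonneg hx2.le (sub_nonneg.mpr h)]
    have := Real.log_le_log (by positivity) hmul
    rw [Real.log_mul (by norm_num) hB.ne', Real.log_mul (by positivity) hD.ne'] at this
    linarith

end
end

section
/- Let H > 300 and let ρ : ℝ² → [0,∞) be a bounded, compactly supported measurable function, supported in the open upper half-plane {x ∈ ℝ² : x₂ > 0}, with ∫_{ℝ²} ρ(x) dx = 1. Set X₂ := ∫_{ℝ²} x₂ ρ(x) dx. Then ∬_{ℝ²×ℝ²} ρ(x)ρ(y) log(|x−ȳ|/|x−y|) dx dy ≤ ∬_{ℝ²×ℝ²} ρ(x)ρ(y) φ(|x−y|) dx dy + g^H(2X₂) + 300/H. -/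
open MeasureTheory Real

noncomputable section

lemma norm_sub_bar_sq (x y : E2) : ‖x - bar y‖ ^ 2 = ‖x - y‖ ^ 2 + 4 * (x 1 * y 1) := by
  simp only [EuclideanSpace.real_norm_sq_eq, Fin.sum_univ_two, bar, pt]
  simp
  ring

lemma measurable_bar : Measurable bar := by
  have h : Continuous bar := by
    unfold bar pt
    refine (PiLp.continuous_toLp 2 _).comp ?_
    refine continuous_pi fun i => ?_
    fin_cases i
    · simp only [Fin.zero_eta, Matrix.cons_val_zero]; fun_prop
    · simp only [Fin.mk_one, Matrix.cons_val_one, Matrix.cons_val_fin_one]; fun_prop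
  exact h.measurable

lemma measurable_phi : Measurable phi :=
  Measurable.ite measurableSet_Iio measurable_log.neg measurable_const

lemma log_le_log_add_div {x M : ℝ} (hx : 0 < x) (hM : 0 < M) :
    log x ≤ log M + (x - M) / M := by
  have h := log_le_sub_one_of_pos (div_pos hx hM)
  rw [log_div hx.ne' hM.ne'] at h
  rw [sub_div, div_self hM.ne']
  linarith

lemma log_div_norm_nonneg {x y : E2} (hx : 0 < x 1) (hy : 0 < y 1) :
    0 ≤ log (‖x - bar y‖ / ‖x - y‖) := by
  rcases eq_or_ne x y with rfl | hne
  · simp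
  have hs : 0 < ‖x - y‖ := norm_pos_iff.2 (sub_ne_zero.2 hne)
  refine log_nonneg ((one_le_div hs).2 ?_)
  refine le_of_sq_le_sq ?_ (norm_nonneg _)
  rw [norm_sub_bar_sq]
  nlinarith [mul_pos hx hy]

/-- The kernel exceeds `phi` by at most the logarithm of the sum of the heights plus `3`. -/
lemma log_div_norm_le {x y : E2} (hx : 0 < x 1) (hy : 0 < y 1) :
    log (‖x - bar y‖ / ‖x - y‖) ≤ phi ‖x - y‖ + log (x 1 + y 1 + 3) := by
  rcases eq_or_ne x y with rfl | hne
  · simpa [phi] using log_nonneg (by linarith : 1 ≤ x 1 + x 1 + 3)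
  have hs : 0 < ‖x - y‖ := norm_pos_iff.2 (sub_ne_zero.2 hne)
  have hb := norm_sub_bar_sq x y
  have hxy := mul_pos hx hy
  have hbpos : 0 < ‖x - bar y‖ := by
    refine lt_of_le_of_ne (norm_nonneg _) fun h => ?_
    rw [← h] at hb
    nlinarith
  have hamgm : 4 * (x 1 * y 1) ≤ (x 1 + y 1) ^ 2 := by nlinarith [sq_nonneg (x 1 - y 1)]
  rw [log_div hbpos.ne' hs.ne', phi]
  split_ifs with h3
  · have : log ‖x - bar y‖ ≤ log (x 1 + y 1 + 3) := by
      refine log_le_log hbpos (abs_le_of_sq_le_sq' ?_ (by positivity)).2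
      nlinarith
    linarith
  · push Not at h3
    have : log (‖x - bar y‖ * 3) ≤ log ((x 1 + y 1 + 3) * ‖x - y‖) := by
      refine log_le_log (by positivity) (abs_le_of_sq_le_sq' ?_ (by positivity)).2
      rw [mul_pow, mul_pow, hb]
      have h9 : (3 : ℝ) ^ 2 ≤ ‖x - y‖ ^ 2 := by gcongr
      nlinarith [mul_le_mul hamgm h9 (by norm_num) (sq_nonneg _),
        mul_nonneg (mul_nonneg (by norm_num : (0:ℝ) ≤ 6) (add_pos hx hy).le) (sq_nonneg ‖x - y‖)]
    rw [log_mul hbpos.ne' (by norm_num), log_mul (by positivity) hs.ne'] at this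
    linarith

lemma integrable_phi_norm_add_log_three : Integrable fun z : E2 => phi ‖z‖ + log 3 := by
  rw [integrable_fun_norm_addHaar volume (f := fun s => phi s + log 3)]
  have hdim : Module.finrank ℝ E2 = 2 := by simp
  rw [hdim]
  have hcont : Continuous fun s : ℝ => -(s * log s) + s * log 3 :=
    continuous_mul_log.neg.add (continuous_id.mul continuous_const)
  have hint : IntegrableOn (fun s : ℝ => -(s * log s) + s * log 3) (Set.Ico 0 3) :=
    (hcont.continuousOn.integrableOn_Icc (a := 0) (b := 3)).mono_set Set.Ico_subset_Icc_self
  have hind := (hint.integrable_indicator measurableSet_Ico).integrableOn (s := Set.Ioi 0)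
  refine hind.congr_fun (fun s hs => ?_) measurableSet_Ioi
  have hs0 : 0 ≤ s := le_of_lt hs
  by_cases h3 : s < 3 <;> simp [phi, h3, hs0, Set.indicator]
  ring

lemma exists_log_tangent_le_gH {H m : ℝ} (hH : 300 < H) :
    ∃ M : ℝ, 0 < M ∧ log M + (m - M) / M + 3 / M ≤ gH H m + 300 / H := by
  have hH0 : 0 < H := by linarith
  by_cases h : H ≤ m
  · have hm : 0 < m := hH0.trans_le h
    refine ⟨m, hm, ?_⟩
    have : 3 / m ≤ 300 / H := div_le_div₀ (by norm_num) (by norm_num) hH0 h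
    simp only [gH, h, if_true, sub_self, zero_div]
    linarith
  · refine ⟨H, hH0, ?_⟩
    have : 3 / H ≤ 300 / H := by gcongr; norm_num
    simp only [gH, h, if_false]
    linarith

lemma integrable_coord_mul {ρ : E2 → ℝ} (hcs : HasCompactSupport ρ) (hρ : Integrable ρ)
    (i : Fin 2) : Integrable fun x : E2 => x i * ρ x := by
  obtain ⟨C, hC⟩ := hcs.isCompact.isBounded.exists_norm_le
  refine (hρ.norm.const_mul C).mono'
    ((by fun_prop : Continuous fun x : E2 => x i).aestronglyMeasurable.mul
      hρ.aestronglyMeasurable) (.of_forall fun x => ?_)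
  rw [norm_mul]
  by_cases hx : ρ x = 0
  · simp [hx]
  · have := (PiLp.norm_apply_le x i).trans (hC x (subset_tsupport _ hx))
    gcongr

lemma integrable_mul_mul_phi {ρ : E2 → ℝ} (hρ : Integrable ρ) {M : ℝ} (hM : ∀ x, ‖ρ x‖ ≤ M) :
    Integrable (fun p : E2 × E2 => ρ p.1 * ρ p.2 * phi ‖p.1 - p.2‖) (volume.prod volume) := by
  have h1 := (hρ.convolution_integrand (ContinuousLinearMap.mul ℝ ℝ)
    integrable_phi_norm_add_log_three).bdd_mul hρ.aestronglyMeasurable.comp_fst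
    (.of_forall fun p => hM p.1)
  refine (h1.sub ((hρ.mul_prod hρ).mul_const (log 3))).congr (.of_forall fun p => ?_)
  simp only [ContinuousLinearMap.mul_apply', Pi.sub_apply]
  ring

/-- Integrated kernel estimate: for `H > 300` and `ρ ≥ 0` bounded, compactly supported,
supported in the open upper half-plane, with unit mass and vertical center of mass `X₂`,
`∬ ρ(x)ρ(y) log(|x−ȳ|/|x−y|) ≤ ∬ ρ(x)ρ(y) φ(|x−y|) + g^H(2X₂) + 300/H`. -/
theorem integrated_kernel_estimate (H : ℝ) (hH : 300 < H) (ρ : E2 → ℝ)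
    (hmeas : Measurable ρ) (hpos : ∀ x, 0 ≤ ρ x)
    (hbdd : ∃ M : ℝ, ∀ x, ρ x ≤ M)
    (hcs : HasCompactSupport ρ)
    (hsupp : Function.support ρ ⊆ {x : E2 | 0 < x 1})
    (hmass : ∫ x : E2, ρ x = 1) :
    (∫ x : E2, ∫ y : E2, ρ x * ρ y * Real.log (‖x - bar y‖ / ‖x - y‖))
      ≤ (∫ x : E2, ∫ y : E2, ρ x * ρ y * phi ‖x - y‖)
        + gH H (2 * ∫ x : E2, x 1 * ρ x) + 300 / H := by
  obtain ⟨B, hB⟩ := hbdd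
  have hρ : Integrable ρ := by
    by_contra h
    simp [integral_undef h] at hmass
  have hX := integrable_coord_mul hcs hρ 1
  have hφ := integrable_mul_mul_phi hρ (M := B) fun x => by
    rw [norm_of_nonneg (hpos x)]; exact hB x
  obtain ⟨M, hM, hMle⟩ := exists_log_tangent_le_gH (m := 2 * ∫ x : E2, x 1 * ρ x) hH
  set X := ∫ x : E2, x 1 * ρ x
  let a := log M - 1 + 3 / M
  have hA : Integrable (fun p : E2 × E2 => a * (ρ p.1 * ρ p.2)) (volume.prod volume) :=
    (hρ.mul_prod hρ).const_mul a
  have hL : Integrable (fun p : E2 × E2 => p.1 1 * ρ p.1 * ρ p.2 + ρ p.1 * (p.2 1 * ρ p.2))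
      (volume.prod volume) := (hX.mul_prod hρ).add (hρ.mul_prod hX)
  have hLM := hL.const_mul (1 / M)
  have hpt (p : E2 × E2) : 0 ≤ ρ p.1 * ρ p.2 * log (‖p.1 - bar p.2‖ / ‖p.1 - p.2‖) ∧
      ρ p.1 * ρ p.2 * log (‖p.1 - bar p.2‖ / ‖p.1 - p.2‖) ≤
        ρ p.1 * ρ p.2 * phi ‖p.1 - p.2‖ + a * (ρ p.1 * ρ p.2) +
          1 / M * (p.1 1 * ρ p.1 * ρ p.2 + ρ p.1 * (p.2 1 * ρ p.2)) := by
    by_cases h1 : ρ p.1 = 0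
    · simp [h1]
    by_cases h2 : ρ p.2 = 0
    · simp [h2]
    have hx : 0 < p.1 1 := hsupp h1
    have hy : 0 < p.2 1 := hsupp h2
    have hρρ := mul_nonneg (hpos p.1) (hpos p.2)
    refine ⟨mul_nonneg hρρ (log_div_norm_nonneg hx hy), ?_⟩
    have hle := (log_div_norm_le hx hy).trans
      (add_le_add_right (log_le_log_add_div (by positivity : 0 < p.1 1 + p.2 1 + 3) hM) _)
    refine (mul_le_mul_of_nonneg_left hle hρρ).trans_eq ?_
    simp only [a]
    field_simp
    ring
  have hK : Integrable (fun p : E2 × E2 =>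
      ρ p.1 * ρ p.2 * log (‖p.1 - bar p.2‖ / ‖p.1 - p.2‖)) (volume.prod volume) := by
    refine ((hφ.add hA).add hLM).mono' (Measurable.aestronglyMeasurable ?_)
      (.of_forall fun p => ?_)
    · have := measurable_bar
      fun_prop
    · rw [norm_of_nonneg (hpt p).1]
      exact (hpt p).2
  rw [integral_integral (f := fun x y => ρ x * ρ y * log (‖x - bar y‖ / ‖x - y‖)) hK,
    integral_integral (f := fun x y => ρ x * ρ y * phi ‖x - y‖) hφ]
  have hmono := integral_mono hK ((hφ.add hA).add hLM) fun p => (hpt p).2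
  rw [integral_add' (hφ.add hA) hLM, integral_add' hφ hA, integral_const_mul, integral_const_mul,
    integral_prod_mul, integral_add (hX.mul_prod hρ) (hρ.mul_prod hX),
    integral_prod_mul (fun x : E2 => x 1 * ρ x) ρ,
    integral_prod_mul ρ (fun x : E2 => x 1 * ρ x), hmass] at hmono
  have hrw : a * (1 * 1) + 1 / M * (X * 1 + 1 * X) = log M + (2 * X - M) / M + 3 / M := by
    simp only [a]
    field_simp
    ring
  linarith

end
end

section
/- Let ε ∈ (0, 1/1000), let p = (p₁,p₂) ∈ Q satisfy p₁ > 8ε⁻¹p₂, and let λ > 0 satisfy λ < (1/4)p₂ε. Then every nonnegative ρ₀ ∈ L¹(Q) with ∫_Q ρ₀ dx = 1 and supp ρ₀ ⊂ B(p,λ) satisfies: X₀₂ := ∫_{ℝ²} x₂ ρ₀(x) dx > ε⁻¹λ, E₄[ρ₀] − log(2X₀₂) ≥ −ε, and E₂[ρ₀] + E₃[ρ₀] ≥ −ε. -/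
open MeasureTheory Real

noncomputable section

/-- The reflection `(x₁, x₂) ↦ (−x₁, x₂)`. -/
def tld (y : E2) : E2 := pt (-(y 0)) (y 1)

/-- The open first quadrant `Q = {x : x₁ > 0, x₂ > 0}`. -/
def Q : Set E2 := {x : E2 | 0 < x 0 ∧ 0 < x 1}

/-- `E₂[ρ] = ∬ ρ(x)ρ(y) log|x−ỹ| dx dy`. -/
def EE2 (ρ : E2 → ℝ) : ℝ := ∫ x : E2, ∫ y : E2, ρ x * ρ y * Real.log ‖x - tld y‖

/-- `E₃[ρ] = ∬ ρ(x)ρ(y)(−log|x+y|) dx dy`. -/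
def EE3 (ρ : E2 → ℝ) : ℝ := ∫ x : E2, ∫ y : E2, ρ x * ρ y * (-Real.log ‖x + y‖)

/-- `E₄[ρ] = ∬ ρ(x)ρ(y) log|x−ȳ| dx dy`. -/
def EE4 (ρ : E2 → ℝ) : ℝ := ∫ x : E2, ∫ y : E2, ρ x * ρ y * Real.log ‖x - bar y‖

/-- A nonnegative unit-mass density that vanishes off a closed ball has an integrable logarithmic
energy density as soon as the kernel `log ‖G‖` is nonsingular on the square of the ball. -/
lemma integrable_mul_mul_log_norm {ρ : E2 → ℝ} {p : E2} {r : ℝ} (hint : Integrable ρ volume)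
    (hsupp : Function.support ρ ⊆ Metric.closedBall p r) {G : E2 × E2 → E2} (hG : Continuous G)
    (hne : ∀ x ∈ Metric.closedBall p r, ∀ y ∈ Metric.closedBall p r, G (x, y) ≠ 0) :
    Integrable (fun z : E2 × E2 => ρ z.1 * ρ z.2 * Real.log ‖G z‖) (volume.prod volume) := by
  have hcomp : IsCompact (Metric.closedBall p r ×ˢ Metric.closedBall p r) :=
    (isCompact_closedBall p r).prod (isCompact_closedBall p r)
  obtain ⟨C, hC⟩ := hcomp.exists_bound_of_continuousOn (f := fun z => Real.log ‖G z‖)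
    (hG.norm.continuousOn.log fun z hz => norm_ne_zero_iff.mpr (hne z.1 hz.1 z.2 hz.2))
  have hρ := hint.mul_prod hint
  refine (hρ.norm.const_mul C).mono'
    (hρ.aestronglyMeasurable.mul hG.measurable.norm.log.aestronglyMeasurable)
    (Filter.Eventually.of_forall fun z => ?_)
  rw [norm_mul, mul_comm C]
  by_cases h : ρ z.1 * ρ z.2 = 0
  · simp [h]
  · gcongr
    exact hC z ⟨hsupp (left_ne_zero_of_mul h), hsupp (right_ne_zero_of_mul h)⟩

/-- The average of a function against a unit-mass product density is at least any lower bound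
of the function on the support. -/
lemma le_integral_mul_mul {ρ : E2 → ℝ} {s : Set E2} (hpos : ∀ x, 0 ≤ ρ x)
    (hint : Integrable ρ volume) (hmass : ∫ x, ρ x = 1) (hsupp : Function.support ρ ⊆ s)
    {K : E2 × E2 → ℝ} {m : ℝ}
    (hK : Integrable (fun z : E2 × E2 => ρ z.1 * ρ z.2 * K z) (volume.prod volume))
    (hm : ∀ x ∈ s, ∀ y ∈ s, m ≤ K (x, y)) :
    m ≤ ∫ z : E2 × E2, ρ z.1 * ρ z.2 * K z ∂(volume.prod volume) := by
  have hconst : ∫ z : E2 × E2, ρ z.1 * ρ z.2 * m ∂(volume.prod volume) = m := by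
    rw [integral_mul_const, integral_prod_mul, hmass]
    ring
  rw [← hconst]
  refine integral_mono ((hint.mul_prod hint).mul_const m) hK fun z => ?_
  by_cases h : ρ z.1 * ρ z.2 = 0
  · simp [h]
  · exact mul_le_mul_of_nonneg_left
      (hm z.1 (hsupp (left_ne_zero_of_mul h)) z.2 (hsupp (right_ne_zero_of_mul h)))
      (mul_nonneg (hpos _) (hpos _))

lemma abs_apply_le_norm (x : E2) (i : Fin 2) : |x i| ≤ ‖x‖ :=
  PiLp.norm_apply_le x i

lemma apply_bounds {x p : E2} {r : ℝ} (hx : x ∈ Metric.closedBall p r) (i : Fin 2) :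
    p i - r ≤ x i ∧ x i ≤ p i + r := by
  have h := (abs_apply_le_norm (x - p) i).trans (mem_closedBall_iff_norm.mp hx)
  rw [PiLp.sub_apply, abs_le] at h
  constructor <;> linarith

lemma integral_apply_mul_bounds {ρ : E2 → ℝ} {p : E2} {r : ℝ} (hpos : ∀ x, 0 ≤ ρ x)
    (hint : Integrable ρ volume) (hmass : ∫ x, ρ x = 1)
    (hsupp : Function.support ρ ⊆ Metric.closedBall p r) (i : Fin 2) :
    p i - r ≤ ∫ x : E2, x i * ρ x ∧ ∫ x : E2, x i * ρ x ≤ p i + r := by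
  have hb : ∀ x, (p i - r) * ρ x ≤ x i * ρ x ∧ x i * ρ x ≤ (p i + r) * ρ x := fun x => by
    by_cases h : ρ x = 0
    · simp [h]
    · obtain ⟨h₁, h₂⟩ := apply_bounds (hsupp h) i
      exact ⟨mul_le_mul_of_nonneg_right h₁ (hpos x), mul_le_mul_of_nonneg_right h₂ (hpos x)⟩
  have hcont : Continuous fun x : E2 => x i := by fun_prop
  have hi : Integrable (fun x : E2 => x i * ρ x) volume :=
    integrable_of_le_of_le (hcont.aestronglyMeasurable.mul hint.aestronglyMeasurable)
      (Filter.Eventually.of_forall fun x => (hb x).1)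
      (Filter.Eventually.of_forall fun x => (hb x).2) (hint.const_mul _) (hint.const_mul _)
  have hlo := integral_mono (hint.const_mul (p i - r)) hi fun x => (hb x).1
  have hhi := integral_mono hi (hint.const_mul (p i + r)) fun x => (hb x).2
  rw [integral_const_mul, hmass, mul_one] at hlo hhi
  exact ⟨hlo, hhi⟩

lemma continuous_bar : Continuous bar := by
  refine (PiLp.continuous_toLp 2 _).comp (continuous_pi fun i => ?_)
  fin_cases i
  · exact (by fun_prop : Continuous fun y : E2 => y 0)
  · exact (by fun_prop : Continuous fun y : E2 => -(y 1))

lemma continuous_tld : Continuous tld := by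
  refine (PiLp.continuous_toLp 2 _).comp (continuous_pi fun i => ?_)
  fin_cases i
  · exact (by fun_prop : Continuous fun y : E2 => -(y 0))
  · exact (by fun_prop : Continuous fun y : E2 => y 1)

lemma add_apply_one_le_norm_sub_bar (x y : E2) : x 1 + y 1 ≤ ‖x - bar y‖ := by
  have h := (le_abs_self _).trans (abs_apply_le_norm (x - bar y) 1)
  simpa [bar, pt] using h

lemma add_apply_zero_le_norm_sub_tld (x y : E2) : x 0 + y 0 ≤ ‖x - tld y‖ := by
  have h := (le_abs_self _).trans (abs_apply_le_norm (x - tld y) 0)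
  simpa [tld, pt] using h

lemma norm_add_le_norm_sub_tld_add (x y : E2) : ‖x + y‖ ≤ ‖x - tld y‖ + 2 * |y 1| := by
  have h : x + y = (x - tld y) + pt 0 (2 * y 1) := by
    ext i
    fin_cases i
    · simp [tld, pt]
    · simp [tld, pt]
      ring
  have hn : ‖pt 0 (2 * y 1)‖ = 2 * |y 1| := by
    rw [EuclideanSpace.norm_eq]
    simp [pt, Real.sqrt_sq_eq_abs, abs_mul]
  rw [h, ← hn]
  exact norm_add_le _ _

lemma neg_div_le_log_sub_log {a b c : ℝ} (ha : 0 < a) (hb : 0 < b) (h : b ≤ a + c) :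
    -(c / a) ≤ Real.log a - Real.log b := by
  have h₁ := Real.log_le_sub_one_of_pos (div_pos hb ha)
  rw [Real.log_div hb.ne' ha.ne'] at h₁
  have h₂ : b / a - 1 ≤ c / a := by
    rw [div_sub_one ha.ne']
    gcongr
    linarith
  linarith

/-- A concentrated unit-mass vortex near a point `p ∈ Q` with `p₁ > 8ε⁻¹p₂`, supported in
`B(p,λ)` with `λ < p₂ε/4`, satisfies the energy assumptions: `X₀₂ > ε⁻¹λ`,
`E₄[ρ₀] − log(2X₀₂) ≥ −ε`, and `E₂[ρ₀] + E₃[ρ₀] ≥ −ε`. -/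
theorem concentrated_vortex_assumptions (ε : ℝ) (hε : ε ∈ Set.Ioo (0:ℝ) (1/1000))
    (p : E2) (hp : p ∈ Q) (hp1 : p 0 > 8 * ε⁻¹ * p 1)
    (lam : ℝ) (hlam0 : 0 < lam) (hlam : lam < (1/4) * p 1 * ε)
    (ρ₀ : E2 → ℝ) (hpos : ∀ x, 0 ≤ ρ₀ x)
    (hint : Integrable ρ₀ volume)
    (hmass : ∫ x : E2, ρ₀ x = 1)
    (hsupp : Function.support ρ₀ ⊆ Metric.ball p lam) :
    (∫ x : E2, x 1 * ρ₀ x) > ε⁻¹ * lam ∧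
    EE4 ρ₀ - Real.log (2 * ∫ x : E2, x 1 * ρ₀ x) ≥ -ε ∧
    EE2 ρ₀ + EE3 ρ₀ ≥ -ε := by
  obtain ⟨hε0, hε1⟩ := hε
  obtain ⟨-, hp2⟩ := hp
  have hsupp' : Function.support ρ₀ ⊆ Metric.closedBall p lam :=
    hsupp.trans Metric.ball_subset_closedBall
  have hp1' : 8 * p 1 < p 0 * ε := by
    have h := mul_lt_mul_of_pos_right hp1 hε0
    field_simp at h
    linarith
  have hlam' : lam < p 1 / 4000 := by nlinarith
  have hp12 : 8000 * p 1 < p 0 := by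
    by_contra! h
    nlinarith [mul_le_mul_of_nonneg_right h hε0.le]
  obtain ⟨hXlo, hXhi⟩ := integral_apply_mul_bounds hpos hint hmass hsupp' 1
  set X := ∫ x : E2, x 1 * ρ₀ x
  refine ⟨?_, ?_, ?_⟩
  · refine lt_of_lt_of_le ?_ hXlo
    rw [inv_mul_lt_iff₀ hε0]
    nlinarith
  · have hG : Continuous fun z : E2 × E2 => z.1 - bar z.2 :=
      continuous_fst.sub (continuous_bar.comp continuous_snd)
    have hlow : ∀ x ∈ Metric.closedBall p lam, ∀ y ∈ Metric.closedBall p lam,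
        2 * (p 1 - lam) ≤ ‖x - bar y‖ := fun x hx y hy => by
      linarith [add_apply_one_le_norm_sub_bar x y, (apply_bounds hx 1).1, (apply_bounds hy 1).1]
    have hI := integrable_mul_mul_log_norm hint hsupp' hG fun x hx y hy =>
      norm_pos_iff.mp (by linarith [hlow x hx y hy])
    have hE : EE4 ρ₀ = _ := (integral_prod _ hI).symm
    have hE_lo : Real.log (2 * (p 1 - lam)) ≤ EE4 ρ₀ := by
      rw [hE]
      exact le_integral_mul_mul hpos hint hmass hsupp' hI fun x hx y hy =>
        Real.log_le_log (by linarith) (hlow x hx y hy)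
    have hlog := neg_div_le_log_sub_log (a := 2 * (p 1 - lam)) (b := 2 * X) (c := 4 * lam)
      (by linarith) (by linarith) (by linarith)
    have hdiv : 4 * lam / (2 * (p 1 - lam)) ≤ ε := by
      rw [div_le_iff₀ (by linarith)]
      nlinarith
    linarith
  · have hlow : ∀ x ∈ Metric.closedBall p lam, ∀ y ∈ Metric.closedBall p lam,
        2 * (p 0 - lam) ≤ x 0 + y 0 := fun x hx y hy => by
      linarith [(apply_bounds hx 0).1, (apply_bounds hy 0).1]
    have htld : ∀ x ∈ Metric.closedBall p lam, ∀ y ∈ Metric.closedBall p lam,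
        0 < ‖x - tld y‖ := fun x hx y hy => by
      linarith [hlow x hx y hy, add_apply_zero_le_norm_sub_tld x y]
    have hadd : ∀ x ∈ Metric.closedBall p lam, ∀ y ∈ Metric.closedBall p lam,
        0 < ‖x + y‖ := fun x hx y hy => by
      have h := (le_abs_self _).trans (abs_apply_le_norm (x + y) 0)
      rw [PiLp.add_apply] at h
      linarith [hlow x hx y hy]
    have hI₂ := integrable_mul_mul_log_norm hint hsupp'
      (continuous_fst.sub (continuous_tld.comp continuous_snd)) fun x hx y hy =>
        norm_pos_iff.mp (htld x hx y hy)
    have hI₃ : Integrable (fun z : E2 × E2 => ρ₀ z.1 * ρ₀ z.2 * -Real.log ‖z.1 + z.2‖)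
        (volume.prod volume) := by
      have h := (integrable_mul_mul_log_norm hint hsupp' (G := fun z => z.1 + z.2)
        (continuous_fst.add continuous_snd) fun x hx y hy =>
          norm_pos_iff.mp (hadd x hx y hy)).neg
      simpa only [Pi.neg_def, mul_neg] using h
    have hE₂ : EE2 ρ₀ = _ := (integral_prod _ hI₂).symm
    have hE₃ : EE3 ρ₀ = _ := (integral_prod _ hI₃).symm
    rw [hE₂, hE₃, ← integral_add hI₂ hI₃]
    have hI := hI₂.add hI₃
    simp only [Pi.add_def, ← mul_add] at hI ⊢
    refine le_integral_mul_mul hpos hint hmass hsupp' hI fun x hx y hy => ?_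
    have hlog := neg_div_le_log_sub_log (htld x hx y hy) (hadd x hx y hy)
      (norm_add_le_norm_sub_tld_add x y)
    have hdiv : 2 * |y 1| / ‖x - tld y‖ ≤ ε := by
      obtain ⟨hy₁, hy₂⟩ := apply_bounds hy 1
      rw [div_le_iff₀ (htld x hx y hy), abs_of_nonneg (by linarith)]
      have h := hlow x hx y hy
      nlinarith [add_apply_zero_le_norm_sub_tld x y]
    change -ε ≤ Real.log ‖x - tld y‖ + -Real.log ‖x + y‖
    linarith

end
end

section
/- There exists an absolute constant C > 0 such that for every A ≥ 1, every δ ∈ (0, e⁻¹), every p ∈ ℝ², and all measurable functions f, g : ℝ² → ℝ supported in B(p,δ) with ‖g‖_{L^∞} ≤ 2Aδ⁻² and ‖f‖_{L¹} ≤ δ, one has |∬_{ℝ²×ℝ²} f(x) g(y) log|x−y| dx dy| ≤ C·A·δ·|log δ|. -/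
open MeasureTheory Real

noncomputable section

/-- The function `1 + |log r|` cut off at radius `2`. -/
def truncatedLog : ℝ → ℝ := (Set.Iio 2).indicator fun r => 1 + |Real.log r|

lemma truncatedLog_nonneg (r : ℝ) : 0 ≤ truncatedLog r :=
  Set.indicator_nonneg (fun _ _ => by positivity) r

/-- The radial profile `1 + |log ‖w‖|` is integrable on the disc of radius `2` in the plane. -/
lemma integrable_truncatedLog_norm : Integrable (fun w : E2 => truncatedLog ‖w‖) := by
  rw [integrable_fun_norm_addHaar volume (f := truncatedLog)]
  have hcont : Continuous fun r : ℝ => |r| + |r * Real.log r| :=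
    continuous_abs.add Real.continuous_mul_log.abs
  have hint : IntegrableOn (fun r : ℝ => |r| + |r * Real.log r|) (Set.Ioo 0 2) :=
    (hcont.integrableOn_Icc (a := 0) (b := 2)).mono_set Set.Ioo_subset_Icc_self
  have hind := ((integrable_indicator_iff measurableSet_Ioo).mpr hint).integrableOn (s := Set.Ioi 0)
  refine hind.congr_fun (fun r hr => ?_) measurableSet_Ioi
  have hr0 : 0 < r := hr
  by_cases h2 : r < 2
  · simp [truncatedLog, Set.indicator, h2, hr0, abs_mul, abs_of_pos hr0]
    ring
  · simp [truncatedLog, Set.indicator, h2]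

/-- After rescaling by `δ`, the logarithm is controlled by `|log δ|` times a fixed profile. -/
lemma abs_log_le_mul_truncatedLog {δ r : ℝ} (hδ : 0 < δ) (hlog : 1 ≤ |Real.log δ|)
    (hr : 0 ≤ r) (hr2 : r < 2 * δ) :
    |Real.log r| ≤ |Real.log δ| * truncatedLog (δ⁻¹ * r) := by
  have hlt : δ⁻¹ * r < 2 := by
    rw [inv_mul_lt_iff₀ hδ]; linarith
  have hval : truncatedLog (δ⁻¹ * r) = 1 + |Real.log (δ⁻¹ * r)| :=
    Set.indicator_of_mem (Set.mem_Iio.mpr hlt) _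
  rw [hval]
  rcases hr.eq_or_lt with rfl | hr0
  · simp
  have hsplit : Real.log r = Real.log δ + Real.log (δ⁻¹ * r) := by
    rw [← Real.log_mul hδ.ne' (by positivity), mul_inv_cancel_left₀ hδ.ne']
  calc |Real.log r| ≤ |Real.log δ| + |Real.log (δ⁻¹ * r)| := by
        rw [hsplit]; exact abs_add_le _ _
    _ ≤ |Real.log δ| * (1 + |Real.log (δ⁻¹ * r)|) := by
        nlinarith [abs_nonneg (Real.log (δ⁻¹ * r))]

/-- There is an absolute constant `C > 0` such that for every `A ≥ 1`, `δ ∈ (0, e⁻¹)`,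
`p ∈ ℝ²`, and all measurable `f, g` supported in `B(p,δ)` with `‖g‖_∞ ≤ 2Aδ⁻²` and
`‖f‖_{L¹} ≤ δ`, one has `|∬ f(x)g(y) log|x−y| dx dy| ≤ C·A·δ·|log δ|`. -/
theorem concentrated_log_interaction_estimate :
    ∃ C : ℝ, 0 < C ∧
      ∀ (A δ : ℝ) (p : E2) (f g : E2 → ℝ),
        1 ≤ A → 0 < δ → δ < (Real.exp 1)⁻¹ →
        Measurable f → Measurable g →
        Integrable f volume →
        Function.support f ⊆ Metric.ball p δ →
        Function.support g ⊆ Metric.ball p δ →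
        (∀ x, |g x| ≤ 2 * A / δ ^ 2) →
        (∫ x : E2, |f x|) ≤ δ →
        |∫ x : E2, ∫ y : E2, f x * g y * Real.log ‖x - y‖|
          ≤ C * A * δ * |Real.log δ| := by
  set K : ℝ := ∫ w : E2, truncatedLog ‖w‖ with hK
  have hK0 : 0 ≤ K := integral_nonneg fun w => truncatedLog_nonneg _
  refine ⟨2 * (K + 1), by positivity, ?_⟩
  intro A δ p f g hA hδ hδe _ _ hfi hfs hgs hg hf
  have hlog : 1 ≤ |Real.log δ| := by
    have h := Real.log_lt_log hδ hδe
    rw [Real.log_inv, Real.log_exp] at h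
    rw [abs_of_neg (by linarith)]
    linarith
  have hscaled : Integrable fun z : E2 => truncatedLog ‖δ⁻¹ • z‖ :=
    integrable_truncatedLog_norm.comp_smul (inv_ne_zero hδ.ne')
  have hscaledInt (x : E2) : ∫ y : E2, truncatedLog ‖δ⁻¹ • (x - y)‖ = δ ^ 2 * K := by
    rw [integral_sub_left_eq_self (fun z : E2 => truncatedLog ‖δ⁻¹ • z‖) volume x,
      Measure.integral_comp_inv_smul volume (fun w : E2 => truncatedLog ‖w‖) δ]
    simp [hK, abs_of_pos hδ]
  have hinner (x : E2) : ‖∫ y : E2, f x * g y * Real.log ‖x - y‖‖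
      ≤ |f x| * (2 * A * K * |Real.log δ|) := by
    have hbound (y : E2) : ‖f x * g y * Real.log ‖x - y‖‖ ≤
        |f x| * (2 * A / δ ^ 2) * |Real.log δ| * truncatedLog ‖δ⁻¹ • (x - y)‖ := by
      have hnn := truncatedLog_nonneg ‖δ⁻¹ • (x - y)‖
      by_cases hfx : f x = 0
      · simp [hfx]
      by_cases hgy : g y = 0
      · simp only [hgy, mul_zero, zero_mul, norm_zero]
        positivity
      have hx : dist x p < δ := hfs hfx
      have hy : dist y p < δ := hgs hgy
      have hxy : ‖x - y‖ < 2 * δ := by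
        rw [← dist_eq_norm]
        linarith [dist_triangle_right x y p]
      have hl := abs_log_le_mul_truncatedLog hδ hlog (norm_nonneg (x - y)) hxy
      rw [norm_smul, norm_inv, Real.norm_of_nonneg hδ.le] at hnn ⊢
      rw [norm_mul, norm_mul, Real.norm_eq_abs, Real.norm_eq_abs, Real.norm_eq_abs,
        mul_assoc _ |Real.log δ|]
      gcongr
      exact hg y
    refine (norm_integral_le_of_norm_le ((hscaled.comp_sub_left x).const_mul _)
      (ae_of_all _ hbound)).trans_eq ?_
    rw [integral_const_mul, hscaledInt]
    field_simp
  calc |∫ x : E2, ∫ y : E2, f x * g y * Real.log ‖x - y‖|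
      ≤ ∫ x : E2, |f x| * (2 * A * K * |Real.log δ|) :=
        norm_integral_le_of_norm_le (hfi.abs.mul_const _) (ae_of_all _ hinner)
    _ = (∫ x : E2, |f x|) * (2 * A * K * |Real.log δ|) := integral_mul_const _ _
    _ ≤ δ * (2 * A * (K + 1) * |Real.log δ|) := by
        gcongr
        linarith
    _ = 2 * (K + 1) * A * δ * |Real.log δ| := by ring

end
end

section
/- Let p = (p₁,p₂) ∈ Q and define O_pv(p) := {x ∈ Q : (x₁x₂)²/(x₁²+x₂²) = (p₁p₂)²/(p₁²+p₂²)}. Then for every ε > 0 there exists M > 0 such that every x = (x₁,x₂) ∈ O_pv(p) with x₁ ≥ M satisfies |x₂ − p₁p₂/√(p₁²+p₂²)| ≤ ε. -/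
open Real

noncomputable section

/-- Asymptotics of the point vortex orbit: for `p = (p₁,p₂)` in the open first quadrant,
every point `x = (x₁,x₂)` of the orbit `O_pv(p)` (i.e. with
`(x₁x₂)²/(x₁²+x₂²) = (p₁p₂)²/(p₁²+p₂²)`) with sufficiently large `x₁` has
`x₂` within `ε` of `p₁p₂/√(p₁²+p₂²)`. -/
theorem orbit_asymptote (p₁ p₂ : ℝ) (hp₁ : 0 < p₁) (hp₂ : 0 < p₂) :
    ∀ ε : ℝ, 0 < ε → ∃ M : ℝ, 0 < M ∧
      ∀ x₁ x₂ : ℝ, 0 < x₁ → 0 < x₂ →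
        (x₁ * x₂) ^ 2 / (x₁ ^ 2 + x₂ ^ 2) = (p₁ * p₂) ^ 2 / (p₁ ^ 2 + p₂ ^ 2) →
        M ≤ x₁ →
        |x₂ - p₁ * p₂ / Real.sqrt (p₁ ^ 2 + p₂ ^ 2)| ≤ ε := by
  intro ε hε
  have hs : 0 < p₁ ^ 2 + p₂ ^ 2 := by positivity
  have hc : 0 < p₁ * p₂ / √(p₁ ^ 2 + p₂ ^ 2) := by positivity
  have hc2 : (p₁ * p₂) ^ 2 / (p₁ ^ 2 + p₂ ^ 2) = (p₁ * p₂ / √(p₁ ^ 2 + p₂ ^ 2)) ^ 2 := by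
    rw [div_pow, Real.sq_sqrt hs.le]
  rw [hc2]
  generalize p₁ * p₂ / √(p₁ ^ 2 + p₂ ^ 2) = c at hc
  refine ⟨c + (c + ε) * c / ε, by positivity, fun x₁ x₂ hx₁ hx₂ h hM => ?_⟩
  rw [div_eq_iff (by positivity)] at h
  have hle : c ≤ x₂ := by
    refine (sq_le_sq₀ hc.le hx₂.le).1 ?_
    refine le_of_mul_le_mul_left ?_ (pow_pos hx₁ 2)
    nlinarith [sq_nonneg (c * x₂)]
  have hcx : c ≤ x₁ := le_trans (le_add_of_nonneg_right (by positivity)) hM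
  have hMε : (c + ε) * c ≤ x₁ * ε := by
    rw [← div_le_iff₀ hε]
    linarith
  rw [abs_of_nonneg (sub_nonneg.2 hle)]
  by_contra! hlt
  have h₁ : (c + ε) ^ 2 ≤ x₂ ^ 2 := pow_le_pow_left₀ (by positivity) (by linarith) 2
  have h₂ : ((c + ε) * c) ^ 2 ≤ (x₁ * ε) ^ 2 := pow_le_pow_left₀ (by positivity) hMε 2
  have h₃ : 0 ≤ x₁ ^ 2 - c ^ 2 := sub_nonneg.2 (pow_le_pow_left₀ hc.le hcx 2)
  have h₄ : 0 < x₁ ^ 2 * (c * ε) := by positivity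
  nlinarith [mul_le_mul_of_nonneg_right h₁ h₃]

end
end
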